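/- arXiv:2312.06635 — 3 statements merged into one kernel-verified Lean document; each statement's English description precedes it below -/
import Mathlib

section
/- Let α_1, …, α_L ∈ ℝ^{1×d_k} and β_1, …, β_L ∈ ℝ^{1×d_v} be row vectors with strictly positive entries, and let Q_t, K_t ∈ ℝ^{1×d_k}, V_t ∈ ℝ^{1×d_v}. Define G_t = α_tᵀβ_t, cumulative products A_t = α_1 ⊙ ⋯ ⊙ α_t and B_t = β_1 ⊙ ⋯ ⊙ β_t, and the recurrence S_0 = 0, S_t = G_t ⊙ S_{t-1} + K_tᵀ V_t. Then for every t, the output O_t = Q_t S_t ∈ ℝ^{1×d_v} satisfies the parallel form: O_t = Σ_{i=1}^{t} ( (Q_t ⊙ A_t)(K_i / A_i)ᵀ · (V_i / B_i) ) ⊙ B_t, where (Q_t ⊙ A_t)(K_i / A_i)ᵀ is a scalar (dot product of row vectors), / is elementwise division, and ⊙ is the elementwise product. -/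
/-- Variation of constants for a scalar first-order linear recurrence with nonzero gates. -/
theorem linear_recurrence_eq_sum {F : Type*} [Field F] (L : ℕ) (g u x : ℕ → F)
    (hg : ∀ t, 1 ≤ t → t ≤ L → g t ≠ 0) (h0 : x 0 = 0)
    (hx : ∀ t, x (t + 1) = g (t + 1) * x t + u (t + 1)) :
    ∀ t, t ≤ L → x t =
      ∑ i ∈ Finset.Icc 1 t,
        u i * ((∏ s ∈ Finset.Icc 1 t, g s) / ∏ s ∈ Finset.Icc 1 i, g s) := by
  intro t
  induction t with
  | zero => simp [h0]
  | succ n ih =>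
    intro hn
    have hne : ∏ s ∈ Finset.Icc 1 (n + 1), g s ≠ 0 := by
      refine Finset.prod_ne_zero_iff.mpr fun s hs => ?_
      rw [Finset.mem_Icc] at hs
      exact hg s hs.1 (hs.2.trans hn)
    rw [Finset.sum_Icc_succ_top (by omega), div_self hne, mul_one, hx, ih (by omega),
      Finset.mul_sum, Finset.prod_Icc_succ_top (by omega)]
    congr 1
    refine Finset.sum_congr rfl fun i _ => ?_
    ring

/-- Parallel form of gated linear attention: with `S_0 = 0`,
`S_t = (α_tᵀβ_t) ⊙ S_{t-1} + K_tᵀ V_t`, gates strictly positive, cumulative products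
`A_t = α_1 ⊙ ⋯ ⊙ α_t`, `B_t = β_1 ⊙ ⋯ ⊙ β_t`, the output `O_t = Q_t S_t` satisfies
`O_t = Σ_{i=1}^{t} ((Q_t ⊙ A_t)(K_i / A_i)ᵀ · (V_i / B_i)) ⊙ B_t` entrywise. -/
theorem gla_parallel_form (dk dv L : ℕ)
    (α : ℕ → Fin dk → ℝ) (β : ℕ → Fin dv → ℝ)
    (Q K : ℕ → Fin dk → ℝ) (V : ℕ → Fin dv → ℝ)
    (hα : ∀ t, 1 ≤ t → t ≤ L → ∀ k, 0 < α t k)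
    (hβ : ∀ t, 1 ≤ t → t ≤ L → ∀ j, 0 < β t j)
    (S : ℕ → Fin dk → Fin dv → ℝ)
    (hS0 : ∀ k j, S 0 k j = 0)
    (hS : ∀ t k j, S (t + 1) k j =
      (α (t + 1) k * β (t + 1) j) * S t k j + K (t + 1) k * V (t + 1) j) :
    ∀ t, t ≤ L → ∀ (j : Fin dv),
      (∑ k : Fin dk, Q t k * S t k j) =
        ∑ i ∈ Finset.Icc 1 t,
          ((∑ k : Fin dk,
              (Q t k * ∏ s ∈ Finset.Icc 1 t, α s k) *
                (K i k / ∏ s ∈ Finset.Icc 1 i, α s k)) *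
            (V i j / ∏ s ∈ Finset.Icc 1 i, β s j)) *
          (∏ s ∈ Finset.Icc 1 t, β s j) := by
  intro t ht j
  have hsol (k : Fin dk) := linear_recurrence_eq_sum L (fun s => α s k * β s j)
    (fun s => K s k * V s j) (fun s => S s k j)
    (fun s h1 h2 => (mul_pos (hα s h1 h2 k) (hβ s h1 h2 j)).ne') (hS0 k j)
    (fun s => hS s k j) t ht
  simp only [Finset.prod_mul_distrib] at hsol
  simp only [hsol, Finset.mul_sum, Finset.sum_mul]
  rw [Finset.sum_comm]
  refine Finset.sum_congr rfl fun i _ => Finset.sum_congr rfl fun k _ => ?_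
  rw [mul_div_mul_comm]
  ring
end

section
/- Under the gated linear attention recurrence S_0 = 0, S_t = (α_tᵀβ_t) ⊙ S_{t-1} + K_tᵀ V_t with all α_t, β_t entrywise strictly positive, for any chunk length C and any chunk index i, the chunk-level state satisfies the inter-chunk recurrence: S_{(i+1)C} = ( (A_{(i+1)C} / A_{iC})ᵀ (B_{(i+1)C} / B_{iC}) ) ⊙ S_{iC} + Σ_{j=iC+1}^{(i+1)C} ( (A_{(i+1)C} / A_j) ⊙ K_j )ᵀ ( (B_{(i+1)C} / B_j) ⊙ V_j ), where A_t = α_1 ⊙ ⋯ ⊙ α_t and B_t = β_1 ⊙ ⋯ ⊙ β_t are the elementwise cumulative gate products (A_0 = B_0 = 1). -/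
open Finset in
/-- Variation of constants for the scalar recurrence `s_{t+1} = a_{t+1} b_{t+1} s_t + x_{t+1} y_{t+1}`,
expressed through ratios of cumulative products. -/
theorem linear_recurrence_eq_prod_ratio {F : Type*} [Field F] {a b x y s : ℕ → F}
    (ha : ∀ t, 1 ≤ t → a t ≠ 0) (hb : ∀ t, 1 ≤ t → b t ≠ 0)
    (hs : ∀ t, s (t + 1) = a (t + 1) * b (t + 1) * s t + x (t + 1) * y (t + 1))
    {m n : ℕ} (hmn : m ≤ n) :
    s n = (∏ t ∈ Icc 1 n, a t) / (∏ t ∈ Icc 1 m, a t) *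
        ((∏ t ∈ Icc 1 n, b t) / (∏ t ∈ Icc 1 m, b t)) * s m +
      ∑ j ∈ Icc (m + 1) n,
        (∏ t ∈ Icc 1 n, a t) / (∏ t ∈ Icc 1 j, a t) * x j *
          ((∏ t ∈ Icc 1 n, b t) / (∏ t ∈ Icc 1 j, b t) * y j) := by
  have hA (n : ℕ) : ∏ t ∈ Icc 1 n, a t ≠ 0 :=
    prod_ne_zero_iff.mpr fun t ht => ha t (mem_Icc.mp ht).1
  have hB (n : ℕ) : ∏ t ∈ Icc 1 n, b t ≠ 0 :=
    prod_ne_zero_iff.mpr fun t ht => hb t (mem_Icc.mp ht).1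
  induction n, hmn using Nat.le_induction with
  | base => simp [div_self (hA m), div_self (hB m)]
  | succ n hmn ih =>
    rw [sum_Icc_succ_top (by omega), div_self (hA _), div_self (hB _), hs, ih, mul_add, mul_sum,
      prod_Icc_succ_top (by omega), prod_Icc_succ_top (by omega), ← add_assoc]
    congr 1
    · congr 1
      · ring
      · exact sum_congr rfl fun j _ => by ring
    · ring

/-- Inter-chunk recurrence of the chunk-wise form of gated linear attention:
with `S_0 = 0`, `S_t = (α_tᵀβ_t) ⊙ S_{t-1} + K_tᵀ V_t` and strictly positive gates,
for any chunk length `C` and chunk index `i`,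
`S_{(i+1)C} = ((A_{(i+1)C}/A_{iC})ᵀ(B_{(i+1)C}/B_{iC})) ⊙ S_{iC}
  + Σ_{j=iC+1}^{(i+1)C} ((A_{(i+1)C}/A_j) ⊙ K_j)ᵀ ((B_{(i+1)C}/B_j) ⊙ V_j)`,
where `A_t, B_t` are the elementwise cumulative gate products. -/
theorem gla_inter_chunk_recurrence (dk dv : ℕ)
    (α : ℕ → Fin dk → ℝ) (β : ℕ → Fin dv → ℝ)
    (K : ℕ → Fin dk → ℝ) (V : ℕ → Fin dv → ℝ)
    (hα : ∀ t, 1 ≤ t → ∀ k, 0 < α t k)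
    (hβ : ∀ t, 1 ≤ t → ∀ j, 0 < β t j)
    (S : ℕ → Fin dk → Fin dv → ℝ)
    (hS0 : ∀ k j, S 0 k j = 0)
    (hS : ∀ t k j, S (t + 1) k j =
      (α (t + 1) k * β (t + 1) j) * S t k j + K (t + 1) k * V (t + 1) j)
    (C i : ℕ) :
    ∀ (k : Fin dk) (m : Fin dv),
      S ((i + 1) * C) k m =
        (((∏ s ∈ Finset.Icc 1 ((i + 1) * C), α s k) /
            (∏ s ∈ Finset.Icc 1 (i * C), α s k)) *
          ((∏ s ∈ Finset.Icc 1 ((i + 1) * C), β s m) /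
            (∏ s ∈ Finset.Icc 1 (i * C), β s m))) * S (i * C) k m +
        ∑ j ∈ Finset.Icc (i * C + 1) ((i + 1) * C),
          (((∏ s ∈ Finset.Icc 1 ((i + 1) * C), α s k) /
              (∏ s ∈ Finset.Icc 1 j, α s k)) * K j k) *
            (((∏ s ∈ Finset.Icc 1 ((i + 1) * C), β s m) /
              (∏ s ∈ Finset.Icc 1 j, β s m)) * V j m) := by
  intro k m
  exact linear_recurrence_eq_prod_ratio (a := (α · k)) (b := (β · m)) (x := (K · k))
    (y := (V · m)) (s := (S · k m)) (fun t ht => (hα t ht k).ne') (fun t ht => (hβ t ht m).ne')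
    (fun t => hS t k m) (Nat.mul_le_mul_right C i.le_succ)
end

section
/- Under the gated linear attention recurrence S_0 = 0, S_t = (α_tᵀβ_t) ⊙ S_{t-1} + K_tᵀ V_t with output O_t = Q_t S_t, where all α_t, β_t have strictly positive entries, for any chunk length C, chunk index i, and offset 1 ≤ j ≤ C, the output decomposes into cross-chunk and intra-chunk parts: O_{iC+j} = ( (Q_{iC+j} ⊙ (A_{iC+j} / A_{iC})) S_{iC} ) ⊙ (B_{iC+j} / B_{iC}) + Σ_{k=1}^{j} ( (Q_{iC+j} ⊙ (A_{iC+j} / A_{iC+k})) K_{iC+k}ᵀ · (V_{iC+k} ⊙ (B_{iC+j} / B_{iC+k})) ), where A_t and B_t are the elementwise cumulative products of the α's and β's respectively, and (Q ⊙ a) Kᵀ is a scalar dot product. -/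
/-- Unrolling a first-order linear recurrence with nonvanishing gates from time `n` to `n + j`. -/
theorem linear_recurrence_unroll {F : Type*} [Field F] (g x s : ℕ → F)
    (hg : ∀ t, 1 ≤ t → g t ≠ 0) (hs : ∀ t, s (t + 1) = g (t + 1) * s t + x (t + 1)) (n j : ℕ) :
    s (n + j) =
      ((∏ r ∈ Finset.Icc 1 (n + j), g r) / ∏ r ∈ Finset.Icc 1 n, g r) * s n +
        ∑ p ∈ Finset.Icc 1 j,
          ((∏ r ∈ Finset.Icc 1 (n + j), g r) / ∏ r ∈ Finset.Icc 1 (n + p), g r) * x (n + p) := by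
  have hprod (t : ℕ) : ∏ r ∈ Finset.Icc 1 t, g r ≠ 0 :=
    Finset.prod_ne_zero_iff.mpr fun r hr => hg r (Finset.mem_Icc.mp hr).1
  induction j with
  | zero => simp [div_self (hprod n)]
  | succ j ih =>
    have hstep : ∏ r ∈ Finset.Icc 1 (n + (j + 1)), g r =
        g (n + (j + 1)) * ∏ r ∈ Finset.Icc 1 (n + j), g r := by
      rw [← add_assoc, Finset.prod_Icc_succ_top (by omega), mul_comm]
    rw [Finset.sum_Icc_succ_top (by omega), div_self (hprod _), one_mul, hstep, ← add_assoc, hs,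
      ih, mul_add, Finset.mul_sum, ← add_assoc]
    simp only [mul_div_assoc, mul_assoc]

/-- Intra-chunk parallel computation of chunk-wise gated linear attention: with
`S_0 = 0`, `S_t = (α_tᵀβ_t) ⊙ S_{t-1} + K_tᵀ V_t`, `O_t = Q_t S_t`, strictly positive
gates, chunk length `C`, chunk index `i`, and offset `1 ≤ j ≤ C`,
`O_{iC+j} = ((Q_{iC+j} ⊙ (A_{iC+j}/A_{iC})) S_{iC}) ⊙ (B_{iC+j}/B_{iC})
  + Σ_{k=1}^{j} ((Q_{iC+j} ⊙ (A_{iC+j}/A_{iC+k})) K_{iC+k}ᵀ) · (V_{iC+k} ⊙ (B_{iC+j}/B_{iC+k}))`. -/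
theorem gla_intra_chunk_decomposition (dk dv : ℕ)
    (α : ℕ → Fin dk → ℝ) (β : ℕ → Fin dv → ℝ)
    (Q K : ℕ → Fin dk → ℝ) (V : ℕ → Fin dv → ℝ)
    (hα : ∀ t, 1 ≤ t → ∀ k, 0 < α t k)
    (hβ : ∀ t, 1 ≤ t → ∀ j, 0 < β t j)
    (S : ℕ → Fin dk → Fin dv → ℝ)
    (hS0 : ∀ k j, S 0 k j = 0)
    (hS : ∀ t k j, S (t + 1) k j =
      (α (t + 1) k * β (t + 1) j) * S t k j + K (t + 1) k * V (t + 1) j)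
    (C i j : ℕ) (hj1 : 1 ≤ j) (hjC : j ≤ C) :
    ∀ (m : Fin dv),
      (∑ k : Fin dk, Q (i * C + j) k * S (i * C + j) k m) =
        (∑ k : Fin dk,
            (Q (i * C + j) k *
              ((∏ s ∈ Finset.Icc 1 (i * C + j), α s k) /
                (∏ s ∈ Finset.Icc 1 (i * C), α s k))) * S (i * C) k m) *
          ((∏ s ∈ Finset.Icc 1 (i * C + j), β s m) /
            (∏ s ∈ Finset.Icc 1 (i * C), β s m)) +
        ∑ p ∈ Finset.Icc 1 j,
          (∑ k : Fin dk,
              (Q (i * C + j) k *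
                ((∏ s ∈ Finset.Icc 1 (i * C + j), α s k) /
                  (∏ s ∈ Finset.Icc 1 (i * C + p), α s k))) * K (i * C + p) k) *
            (V (i * C + p) m *
              ((∏ s ∈ Finset.Icc 1 (i * C + j), β s m) /
                (∏ s ∈ Finset.Icc 1 (i * C + p), β s m))) := by
  intro m
  have unroll (k : Fin dk) := linear_recurrence_unroll (fun t => α t k * β t m)
    (fun t => K t k * V t m) (fun t => S t k m)
    (fun t ht => (mul_pos (hα t ht k) (hβ t ht m)).ne') (fun t => hS t k m) (i * C) j
  simp only [Finset.prod_mul_distrib, mul_div_mul_comm] at unroll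
  simp only [unroll, mul_add, Finset.sum_add_distrib, Finset.mul_sum, Finset.sum_mul]
  congr 1
  · exact Finset.sum_congr rfl fun k _ => by ring
  · rw [Finset.sum_comm]
    exact Finset.sum_congr rfl fun p _ => Finset.sum_congr rfl fun k _ => by ring
end
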